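/- arXiv:math/0606196 — 2 statements merged into one kernel-verified Lean document; each statement's English description precedes it below -/
import Mathlib

section
/- Let σ be the K-algebra automorphism of P_n = K[x_1,…,x_n] (n ≥ 5) with σ(x_1) = x_1 − 1 and σ(x_i) = x_i + x_{i−1} for 2 ≤ i ≤ n, and set μ = ⌊(n−1)/2⌋. Then for every k = 2, …, μ, the polynomial v_k is σ-invariant and has total degree ≤ 3, i.e. v_k ∈ P_n^σ ∩ P_{n,≤3}. -/
noncomputable section

variable (K : Type*) [Field K] [CharZero K]

/-- `xv K n k` is the variable `x_k` (1-based indexing) in `K[x_1,…,x_n]`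
(junk value `0` when out of range). -/
def xv (n k : ℕ) : MvPolynomial (Fin n) K :=
  if h : k - 1 < n then MvPolynomial.X ⟨k - 1, h⟩ else 0

/-- The binomial coefficient `C(a,b)` for integers, with the convention that
`C(a,b) = 0` unless `0 ≤ b ≤ a`. -/
def ch (a b : ℤ) : ℤ := if 0 ≤ b ∧ b ≤ a then (a.toNat.choose b.toNat : ℤ) else 0

/-- `λ^k_{i,j} = (−1)^{k−i}(C(k−i, j−k) + C(k−i−1, j−k−1))`. -/
def lam (k i j : ℕ) : ℤ :=
  (-1) ^ (k - i) * (ch ((k : ℤ) - i) ((j : ℤ) - k) + ch ((k : ℤ) - i - 1) ((j : ℤ) - k - 1))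

/-- `μ^k_i = (−1)^{k−1}(C(k, i−k) + C(k−1, i−k−1))`. -/
def mu (k i : ℕ) : ℤ :=
  (-1) ^ (k - 1) * (ch (k : ℤ) ((i : ℤ) - k) + ch ((k : ℤ) - 1) ((i : ℤ) - k - 1))

/-- `α^k_{i,j} = (−1)^{k−i}(2C(k−i−1, j−k−1) + 3C(k−i−1, j−k−2)
  + (k−i−1)(C(k−i, j−k−1) + C(k−i−1, j−k−2)))`. -/
def alph (k i j : ℕ) : ℤ :=
  (-1) ^ (k - i) *
    (2 * ch ((k : ℤ) - i - 1) ((j : ℤ) - k - 1) + 3 * ch ((k : ℤ) - i - 1) ((j : ℤ) - k - 2)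
      + ((k : ℤ) - i - 1) *
        (ch ((k : ℤ) - i) ((j : ℤ) - k - 1) + ch ((k : ℤ) - i - 1) ((j : ℤ) - k - 2)))

/-- `β^k_j = α^k_{1,j−1} + α^k_{1,j} + μ^k_{j−1}`. -/
def bet (k j : ℕ) : ℤ := alph k 1 (j - 1) + alph k 1 j + mu k (j - 1)

/-- `u_k = x_k² + Σ_{i=1}^{k−1} Σ_{j=k}^{2k−i} λ^k_{i,j} x_i x_j + Σ_{i=k}^{2k} μ^k_i x_i`. -/
def u (n k : ℕ) : MvPolynomial (Fin n) K :=
  xv K n k ^ 2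
    + ∑ i ∈ Finset.Icc 1 (k - 1), ∑ j ∈ Finset.Icc k (2 * k - i),
        lam k i j • (xv K n i * xv K n j)
    + ∑ i ∈ Finset.Icc k (2 * k), mu k i • xv K n i

/-- For `k ≥ 2`:
`v_k = x_1·u_k + x_k x_{k+1} + Σ_{i=1}^{k−1} Σ_{j=k+1}^{2k−i+1} α^k_{i,j} x_i x_j
  + Σ_{i=k+1}^{2k+1} β^k_i x_i`. -/
def v (n k : ℕ) : MvPolynomial (Fin n) K :=
  xv K n 1 * u K n k + xv K n k * xv K n (k + 1)
    + ∑ i ∈ Finset.Icc 1 (k - 1), ∑ j ∈ Finset.Icc (k + 1) (2 * k - i + 1),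
        alph k i j • (xv K n i * xv K n j)
    + ∑ i ∈ Finset.Icc (k + 1) (2 * k + 1), bet k i • xv K n i

/-- `v_1 = x_1³ + 3x_1x_2 − x_1 + 3x_3`. -/
def v1 (n : ℕ) : MvPolynomial (Fin n) K :=
  xv K n 1 ^ 3 + 3 * xv K n 1 * xv K n 2 - xv K n 1 + 3 * xv K n 3

/-- The family `v_k`, `k ≥ 1`. -/
def vv (n k : ℕ) : MvPolynomial (Fin n) K := if k = 1 then v1 K n else v K n k

/-- Pascal's rule for `ch`, valid for every integer lower index. -/
lemma ch_succ {a : ℤ} (ha : 0 ≤ a) (b : ℤ) : ch (a + 1) b = ch a b + ch a (b - 1) := by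
  obtain ⟨a, rfl⟩ := Int.eq_ofNat_of_zero_le ha
  rcases lt_or_ge b 0 with hb | hb
  · simp [ch, not_le.mpr hb, show ¬ (1 ≤ b) by omega]
  obtain ⟨b, rfl⟩ := Int.eq_ofNat_of_zero_le hb
  have key : ∀ m l : ℕ, ch (m : ℤ) (l : ℤ) = (m.choose l : ℤ) := by
    intro m l
    by_cases h : l ≤ m
    · simp [ch, h]
    · simp [ch, h, Nat.choose_eq_zero_of_lt (not_le.mp h)]
  rcases b with _ | b
  · simpa [ch] using ha.trans (Int.le_add_one le_rfl)
  · have h₁ := key (a + 1) (b + 1)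
    have h₂ := key a (b + 1)
    have h₃ := key a b
    push_cast at h₁ h₂ h₃ ⊢
    rw [h₁, h₂, add_sub_cancel_right, h₃, Nat.choose_succ_succ']
    push_cast
    ring

lemma ch_eq_zero_of_neg {a b : ℤ} (h : b < 0) : ch a b = 0 :=
  if_neg fun h' => absurd h'.1 (not_le.mpr h)

lemma ch_eq_zero_of_lt {a b : ℤ} (h : a < b) : ch a b = 0 :=
  if_neg fun h' => absurd h'.2 (not_le.mpr h)

lemma lam_eq_zero {k i j : ℕ} (h : j < k ∨ 2 * k < i + j) : lam k i j = 0 := by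
  rcases h with h | h
  · simp [lam, ch_eq_zero_of_neg (show (j : ℤ) - k < 0 by omega),
      ch_eq_zero_of_neg (show (j : ℤ) - k - 1 < 0 by omega)]
  · simp [lam, ch_eq_zero_of_lt (show (k : ℤ) - i < j - k by omega),
      ch_eq_zero_of_lt (show (k : ℤ) - i - 1 < j - k - 1 by omega)]

lemma alph_eq_zero {k i j : ℕ} (h : j < k + 1 ∨ 2 * k + 1 < i + j) : alph k i j = 0 := by
  rcases h with h | h
  · simp [alph, ch_eq_zero_of_neg (show (j : ℤ) - k - 1 < 0 by omega),
      ch_eq_zero_of_neg (show (j : ℤ) - k - 2 < 0 by omega)]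
  · simp [alph, ch_eq_zero_of_lt (show (k : ℤ) - i < j - k - 1 by omega),
      ch_eq_zero_of_lt (show (k : ℤ) - i - 1 < j - k - 1 by omega),
      ch_eq_zero_of_lt (show (k : ℤ) - i - 1 < j - k - 2 by omega)]

lemma lam_recurrence {k i : ℕ} (hi : i + 2 ≤ k) (j : ℕ) :
    lam k i (j + 1) + lam k (i + 1) j + lam k (i + 1) (j + 1) = 0 := by
  obtain ⟨a, rfl⟩ := Nat.exists_eq_add_of_le hi
  have hs : i + 2 + a - i = (a + 1) + 1 := by omega
  have hs' : i + 2 + a - (i + 1) = a + 1 := by omega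
  simp only [lam, hs, hs', pow_succ]
  push_cast
  have p₁ := ch_succ (a := (a : ℤ) + 1) (by positivity) ((j : ℤ) + 1 - (i + 2 + a))
  have p₂ := ch_succ (a := (a : ℤ)) (by positivity) ((j : ℤ) - (i + 2 + a))
  rw [show (i : ℤ) + 2 + a - i = a + 1 + 1 by ring, add_sub_cancel_right,
    show (i : ℤ) + 2 + a - (i + 1) = a + 1 by ring, add_sub_cancel_right, p₁,
    show (j : ℤ) + 1 - (i + 2 + a) - 1 = j - (i + 2 + a) by ring, p₂]
  ring

lemma alph_recurrence {k i : ℕ} (hi : i + 2 ≤ k) (j : ℕ) :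
    alph k i (j + 1) + alph k (i + 1) j + alph k (i + 1) (j + 1) = lam k i j := by
  obtain ⟨a, rfl⟩ := Nat.exists_eq_add_of_le hi
  have hs : i + 2 + a - i = (a + 1) + 1 := by omega
  have hs' : i + 2 + a - (i + 1) = a + 1 := by omega
  simp only [alph, lam, hs, hs', pow_succ]
  push_cast
  have ha : (0 : ℤ) ≤ a := by positivity
  obtain ⟨b, hb⟩ : ∃ b : ℤ, b = (j : ℤ) - (i + 2 + a) := ⟨_, rfl⟩
  have p₁ := ch_succ (a := (a : ℤ) + 1) (by positivity) b
  have p₂ := ch_succ ha b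
  have p₃ := ch_succ ha (b - 1)
  rw [show (i : ℤ) + 2 + a - i = a + 1 + 1 by ring, add_sub_cancel_right,
    show (i : ℤ) + 2 + a - (i + 1) = a + 1 by ring, add_sub_cancel_right,
    show (j : ℤ) + 1 - (i + 2 + a) - 1 = b by rw [hb]; ring,
    show (j : ℤ) + 1 - (i + 2 + a) - 2 = b - 1 by rw [hb]; ring,
    ← hb, show b - 2 = b - 1 - 1 by ring, p₁, p₂, p₃]
  ring

lemma mu_eq_neg_lam {k : ℕ} (hk : 1 ≤ k) (i : ℕ) : mu k i = -lam k 0 i := by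
  obtain ⟨k, rfl⟩ := Nat.exists_eq_add_of_le' hk
  simp [mu, lam, pow_succ]

lemma bet_eq_neg_alph {k j : ℕ} (hk : 2 ≤ k) (hj : 1 ≤ j) : bet k j = -alph k 0 j := by
  obtain ⟨j, rfl⟩ := Nat.exists_eq_add_of_le' hj
  have h := alph_recurrence (k := k) (i := 0) (by omega) j
  rw [bet, mu_eq_neg_lam (by omega)]
  simp only [Nat.add_sub_cancel, zero_add] at h ⊢
  linarith

section LinearForms

variable {R : Type*} [CommRing R]

/-- The linear form `∑_{j ≤ N} c_j x_j`. -/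
def linForm (x : ℕ → R) (N : ℕ) (c : ℕ → ℤ) : R :=
  ∑ j ∈ Finset.range (N + 1), c j • x j

lemma linForm_eq_sum (x : ℕ → R) {N : ℕ} {c : ℕ → ℤ} {s : Finset ℕ}
    (hs : ∀ j ∈ s, j ≤ N) (hc : ∀ j, j ∉ s → c j = 0) :
    linForm x N c = ∑ j ∈ s, c j • x j := by
  refine (Finset.sum_subset (fun j hj => ?_) fun j _ hj => ?_).symm
  · exact Finset.mem_range_succ_iff.mpr (hs j hj)
  · rw [hc j hj, zero_smul]

/-- The unipotent shift `x_j ↦ x_j + x_{j-1}` acts on the coefficients of a linear form by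
`c_j ↦ c_j + c_{j+1}`. -/
lemma map_linForm (σ : R →+* R) {x : ℕ → R} {N : ℕ} (h₀ : σ (x 0) = x 0)
    (h : ∀ j < N, σ (x (j + 1)) = x (j + 1) + x j) (c : ℕ → ℤ) :
    σ (linForm x N c) = linForm x N c + ∑ j ∈ Finset.range N, c (j + 1) • x j := by
  induction N with
  | zero => simp [linForm, h₀]
  | succ N ih =>
    have ih := ih fun j hj => h j (by omega)
    unfold linForm at ih ⊢
    rw [Finset.sum_range_succ, map_add, ih, map_zsmul, h N (by omega),
      Finset.sum_range_succ (fun j => c (j + 1) • x j) N, smul_add]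
    abel

/-- If the coefficients satisfy `c_{j+1} + d_j + d_{j+1} = e_j`, then
`(σ - 1) C + σ D = E` for the corresponding linear forms. -/
lemma map_linForm_add (σ : R →+* R) {x : ℕ → R} {N : ℕ} (h₀ : σ (x 0) = x 0)
    (h : ∀ j < N, σ (x (j + 1)) = x (j + 1) + x j) {c d e : ℕ → ℤ}
    (hcde : ∀ j, c (j + 1) + d j + d (j + 1) = e j) (hd : d N = 0) (he : e N = 0) :
    σ (linForm x N c) + σ (linForm x N d) = linForm x N c + linForm x N e := by
  rw [map_linForm σ h₀ h, map_linForm σ h₀ h, add_assoc, add_right_inj]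
  simp only [linForm, Finset.sum_range_succ _ N, hd, he, zero_smul, add_zero,
    ← Finset.sum_add_distrib, ← add_smul]
  refine Finset.sum_congr rfl fun j _ => ?_
  rw [← hcde j]
  ring_nf

/-- Telescoping for `∑_{i ≤ m} x_i L_i` when `(σ - 1) L_i + σ L_{i+1} = E_i`. -/
lemma map_sum_mul (σ : R →+* R) {x L E : ℕ → R} (m : ℕ) (h₀ : σ (x 0) = x 0)
    (h : ∀ j < m, σ (x (j + 1)) = x (j + 1) + x j)
    (hL : ∀ i < m, σ (L i) + σ (L (i + 1)) = L i + E i) :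
    σ (∑ i ∈ Finset.range (m + 1), x i * L i) =
      ∑ i ∈ Finset.range (m + 1), x i * L i + ∑ i ∈ Finset.range m, x i * E i
        + x m * (σ (L m) - L m) := by
  induction m with
  | zero => simp [h₀]; ring
  | succ m ih =>
    have ih := ih (fun j hj => h j (by omega)) fun i hi => hL i (by omega)
    rw [Finset.sum_range_succ, map_add, ih, map_mul, h m (by omega),
      Finset.sum_range_succ (fun i => x i * E i) m]
    linear_combination x m * hL m (by omega)

end LinearForms

section Invariants

variable {F : Type*} [Field F]

/-- The sequence `x_0 = -1, x_1, x_2, …`, on which `σ` acts uniformly by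
`x_{j+1} ↦ x_{j+1} + x_j`. -/
def extVar (F : Type*) [Field F] (n j : ℕ) : MvPolynomial (Fin n) F :=
  if j = 0 then -1 else xv F n j

@[simp] lemma extVar_zero (n : ℕ) : extVar F n 0 = -1 := rfl

lemma extVar_of_pos (n : ℕ) {j : ℕ} (hj : 1 ≤ j) : extVar F n j = xv F n j :=
  if_neg (by omega)

lemma sum_extVar_mul_linForm (n : ℕ) {k N : ℕ} (hk : 1 ≤ k) {c : ℕ → ℕ → ℤ} {d : ℕ → ℤ}
    {s : ℕ → Finset ℕ} (hs : ∀ i, ∀ j ∈ s i, 1 ≤ j ∧ j ≤ N) (hc : ∀ i < k, ∀ j ∉ s i, c i j = 0)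
    (hd : ∀ j ∈ s 0, d j = -c 0 j) :
    ∑ i ∈ Finset.range k, extVar F n i * linForm (extVar F n) N (c i) =
      ∑ i ∈ Finset.Icc 1 (k - 1), ∑ j ∈ s i, c i j • (xv F n i * xv F n j)
        + ∑ j ∈ s 0, d j • xv F n j := by
  have hk' : Finset.Ico (0 + 1) k = Finset.Icc 1 (k - 1) := by
    ext i; simp only [Finset.mem_Ico, Finset.mem_Icc]; omega
  rw [Finset.range_eq_Ico, Finset.sum_eq_sum_Ico_succ_bot (by omega), add_comm, hk']
  congr 1
  · refine Finset.sum_congr rfl fun i hi => ?_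
    rw [Finset.mem_Icc] at hi
    rw [linForm_eq_sum _ (fun j hj => (hs i j hj).2) (hc i (by omega)), Finset.mul_sum]
    refine Finset.sum_congr rfl fun j hj => ?_
    rw [extVar_of_pos n hi.1, extVar_of_pos n (hs i j hj).1, mul_smul_comm]
  · rw [linForm_eq_sum _ (fun j hj => (hs 0 j hj).2) (hc 0 (by omega)), Finset.mul_sum]
    refine Finset.sum_congr rfl fun j hj => ?_
    rw [extVar_of_pos n (hs 0 j hj).1, hd j hj, extVar_zero, neg_smul, neg_one_mul]

lemma u_eq (n : ℕ) {k : ℕ} (hk : 1 ≤ k) :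
    u F n k = extVar F n k ^ 2
      + ∑ i ∈ Finset.range k, extVar F n i * linForm (extVar F n) (2 * k + 1) (lam k i) := by
  rw [sum_extVar_mul_linForm n hk (s := fun i => Finset.Icc k (2 * k - i)) (d := mu k),
    u, extVar_of_pos n hk, add_assoc, Nat.sub_zero]
  · intro i j hj
    rw [Finset.mem_Icc] at hj
    omega
  · intro i hi j hj
    rw [Finset.mem_Icc] at hj
    exact lam_eq_zero (by omega)
  · exact fun j _ => mu_eq_neg_lam hk j

lemma v_eq (n : ℕ) {k : ℕ} (hk : 2 ≤ k) :
    v F n k = xv F n 1 * u F n k + (extVar F n k * extVar F n (k + 1)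
      + ∑ i ∈ Finset.range k, extVar F n i * linForm (extVar F n) (2 * k + 1) (alph k i)) := by
  rw [sum_extVar_mul_linForm n (by omega)
      (s := fun i => Finset.Icc (k + 1) (2 * k - i + 1)) (d := bet k),
    v, extVar_of_pos n (by omega), extVar_of_pos n (by omega), Nat.sub_zero]
  · ring
  · intro i j hj
    rw [Finset.mem_Icc] at hj
    omega
  · intro i hi j hj
    rw [Finset.mem_Icc] at hj
    exact alph_eq_zero (by omega)
  · intro j hj
    rw [Finset.mem_Icc] at hj
    exact bet_eq_neg_alph hk (by omega)

lemma linForm_lam_last (n m : ℕ) :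
    linForm (extVar F n) (2 * (m + 1) + 1) (lam (m + 1) m) =
      -(extVar F n (m + 1) + 2 * extVar F n (m + 2)) := by
  rw [linForm_eq_sum (s := {m + 1, m + 2})]
  · rw [Finset.sum_pair (by omega)]
    simp [lam, ch]
    ring
  · simp
    omega
  · intro j hj
    simp only [Finset.mem_insert, Finset.mem_singleton] at hj
    exact lam_eq_zero (by omega)

lemma linForm_alph_last (n m : ℕ) (hm : 1 ≤ m) :
    linForm (extVar F n) (2 * (m + 1) + 1) (alph (m + 1) m) =
      -(2 * extVar F n (m + 2) + 3 * extVar F n (m + 3)) := by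
  rw [linForm_eq_sum (s := {m + 2, m + 3})]
  · rw [Finset.sum_pair (by omega)]
    simp [alph, ch]
    ring
  · simp
    omega
  · intro j hj
    simp only [Finset.mem_insert, Finset.mem_singleton] at hj
    exact alph_eq_zero (by omega)

lemma map_u {n m : ℕ} (σ : MvPolynomial (Fin n) F →+* MvPolynomial (Fin n) F)
    (hσ : ∀ j < n, σ (extVar F n (j + 1)) = extVar F n (j + 1) + extVar F n j)
    (hm : 2 * (m + 1) + 1 ≤ n) : σ (u F n (m + 1)) = u F n (m + 1) := by
  have h₀ : σ (extVar F n 0) = extVar F n 0 := by simp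
  rw [u_eq n (by omega), map_add, map_pow, hσ m (by omega),
    map_sum_mul σ (E := fun _ => 0) m h₀ (fun j hj => hσ j (by omega)), linForm_lam_last]
  · simp only [map_neg, map_add, map_mul, map_ofNat, hσ m (by omega), hσ (m + 1) (by omega),
      mul_zero, Finset.sum_const_zero]
    ring
  · intro i hi
    have h := map_linForm_add σ h₀ (N := 2 * (m + 1) + 1) (fun j hj => hσ j (by omega))
      (e := fun _ => 0) (lam_recurrence (k := m + 1) (i := i) (by omega))
      (lam_eq_zero (by omega)) rfl
    simpa [linForm] using h

lemma map_v {n m : ℕ} (σ : MvPolynomial (Fin n) F →+* MvPolynomial (Fin n) F)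
    (hσ : ∀ j < n, σ (extVar F n (j + 1)) = extVar F n (j + 1) + extVar F n j)
    (hm₁ : 1 ≤ m) (hm : 2 * (m + 1) + 1 ≤ n) : σ (v F n (m + 1)) = v F n (m + 1) := by
  have h₀ : σ (extVar F n 0) = extVar F n 0 := by simp
  have h₁ : σ (xv F n 1) = xv F n 1 - 1 := by
    simpa [extVar_of_pos, sub_eq_add_neg] using hσ 0 (by omega)
  have hu : u F n (m + 1) = extVar F n (m + 1) ^ 2 + (∑ i ∈ Finset.range m,
      extVar F n i * linForm (extVar F n) (2 * (m + 1) + 1) (lam (m + 1) i)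
        + extVar F n m * -(extVar F n (m + 1) + 2 * extVar F n (m + 2))) := by
    rw [u_eq n (by omega), Finset.sum_range_succ, linForm_lam_last]
  rw [v_eq n (by omega), map_add, map_mul, h₁, map_u σ hσ hm, map_add, map_mul,
    map_sum_mul σ m h₀ (fun j hj => hσ j (by omega)) (fun i hi =>
      map_linForm_add σ h₀ (fun j hj => hσ j (by omega))
      (alph_recurrence (k := m + 1) (i := i) (by omega)) (alph_eq_zero (by omega))
      (lam_eq_zero (by omega))), linForm_alph_last n m hm₁]
  simp only [map_neg, map_add, map_mul, map_ofNat, hσ m (by omega), hσ (m + 1) (by omega),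
    hσ (m + 2) (by omega)]
  linear_combination -hu

lemma totalDegree_xv_le (n i : ℕ) : (xv F n i).totalDegree ≤ 1 := by
  unfold xv
  split_ifs
  · simp
  · simp

lemma totalDegree_zsmul_le {ι : Type*} (a : ℤ) (p : MvPolynomial ι F) :
    (a • p).totalDegree ≤ p.totalDegree := by
  rw [← Int.cast_smul_eq_zsmul F]
  exact MvPolynomial.totalDegree_smul_le _ _

open MvPolynomial in
lemma totalDegree_xv_mul_xv_le (n i j : ℕ) : (xv F n i * xv F n j).totalDegree ≤ 2 :=
  (totalDegree_mul _ _).trans (add_le_add (totalDegree_xv_le n i) (totalDegree_xv_le n j))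

open MvPolynomial in
lemma totalDegree_quadratic_le (n : ℕ) (s t : Finset ℕ) (r : ℕ → Finset ℕ) (c : ℕ → ℕ → ℤ)
    (d : ℕ → ℤ) {q : MvPolynomial (Fin n) F} (hq : q.totalDegree ≤ 2) :
    (q + ∑ i ∈ s, ∑ j ∈ r i, c i j • (xv F n i * xv F n j)
      + ∑ i ∈ t, d i • xv F n i).totalDegree ≤ 2 := by
  refine (totalDegree_add _ _).trans (max_le ((totalDegree_add _ _).trans (max_le hq ?_)) ?_)
  · exact totalDegree_finsetSum_le fun i _ => totalDegree_finsetSum_le fun j _ =>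
      (totalDegree_zsmul_le _ _).trans (totalDegree_xv_mul_xv_le n i j)
  · exact totalDegree_finsetSum_le fun i _ =>
      (totalDegree_zsmul_le _ _).trans ((totalDegree_xv_le n i).trans one_le_two)

lemma totalDegree_u_le (n k : ℕ) : (u F n k).totalDegree ≤ 2 :=
  totalDegree_quadratic_le n _ _ _ _ _ (by rw [sq]; exact totalDegree_xv_mul_xv_le n k k)

open MvPolynomial in
lemma totalDegree_v_le (n k : ℕ) : (v F n k).totalDegree ≤ 3 := by
  rw [v, add_assoc, add_assoc, ← add_assoc (xv F n k * _)]
  refine (totalDegree_add _ _).trans (max_le ?_ ?_)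
  · exact (totalDegree_mul _ _).trans
      (add_le_add (totalDegree_xv_le n 1) (totalDegree_u_le n k))
  · exact (totalDegree_quadratic_le n _ _ _ _ _ (totalDegree_xv_mul_xv_le n k (k + 1))).trans
      (by norm_num)

end Invariants


/-- For `n ≥ 5` and `2 ≤ k ≤ μ = ⌊(n−1)/2⌋`, the cubic polynomial `v_k` is `σ`-invariant
of total degree ≤ 3. -/
theorem cubic_invariants {K : Type*} [Field K] [CharZero K] {n : ℕ} (hn : 5 ≤ n)
    (σ : MvPolynomial (Fin n) K ≃ₐ[K] MvPolynomial (Fin n) K)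
    (hσ1 : σ (xv K n 1) = xv K n 1 - 1)
    (hσ : ∀ k, 2 ≤ k → k ≤ n → σ (xv K n k) = xv K n k + xv K n (k - 1)) :
    ∀ k, 2 ≤ k → k ≤ (n - 1) / 2 →
      σ (v K n k) = v K n k ∧ (v K n k).totalDegree ≤ 3 := by
  intro k hk hkn
  obtain ⟨m, rfl⟩ := Nat.exists_eq_add_of_le' (one_le_two.trans hk)
  refine ⟨map_v (σ : MvPolynomial (Fin n) K →+* MvPolynomial (Fin n) K) ?_ (by omega) (by omega),
    totalDegree_v_le n _⟩
  rintro (_ | j) hj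
  · simpa [extVar_of_pos, sub_eq_add_neg] using hσ1
  · simpa [extVar_of_pos] using hσ (j + 2) (by omega) (by omega)
end
end

section
/- Let τ be the K-algebra automorphism of P_{n+1} = K[x_1,…,x_{n+1}] (n ≥ 2) with τ(x_1) = x_1 and τ(x_i) = x_i + x_{i−1} for 2 ≤ i ≤ n+1, set m = ⌊n/2⌋ and μ = ⌊(n−1)/2⌋, and let A = (P_{n+1})_{x_1} be the localization of P_{n+1} at the powers of x_1, with τ also denoting the unique extension of τ to an automorphism of A. Then the fixed subalgebra A^τ = {a ∈ A : τ(a) = a} equals the K-subalgebra of A generated by x_1, x_1^{−1}, p_1, …, p_m, q_1, …, q_μ. -/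
noncomputable section

variable (K : Type*) [Field K] [CharZero K]

/-- `p_k = x_{k+1}² + Σ_{i=1}^{k−1} Σ_{j=k}^{2k−i} λ^k_{i,j} x_{i+1}x_{j+1}
  − x_1·Σ_{i=k}^{2k} μ^k_i x_{i+1}` in `K[x_1,…,x_{n+1}]`. -/
def p (n k : ℕ) : MvPolynomial (Fin (n + 1)) K :=
  xv K (n + 1) (k + 1) ^ 2
    + ∑ i ∈ Finset.Icc 1 (k - 1), ∑ j ∈ Finset.Icc k (2 * k - i),
        lam k i j • (xv K (n + 1) (i + 1) * xv K (n + 1) (j + 1))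
    - xv K (n + 1) 1 * ∑ i ∈ Finset.Icc k (2 * k), mu k i • xv K (n + 1) (i + 1)

/-- `q_1 = x_1³ − x_2³ + 3x_1x_2x_3 + x_1²x_2 − 3x_1²x_4`, and for `k ≥ 2`,
`q_k = −x_2·p_k + x_1 x_{k+1}x_{k+2}
  + x_1·Σ_{i=1}^{k−1} Σ_{j=k+1}^{2k−i+1} α^k_{i,j} x_{i+1}x_{j+1}
  − x_1²·Σ_{i=k+1}^{2k+1} β^k_i x_{i+1}`. -/
def q (n k : ℕ) : MvPolynomial (Fin (n + 1)) K :=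
  if k = 1 then
    xv K (n + 1) 1 ^ 3 - xv K (n + 1) 2 ^ 3
      + 3 * xv K (n + 1) 1 * xv K (n + 1) 2 * xv K (n + 1) 3
      + xv K (n + 1) 1 ^ 2 * xv K (n + 1) 2 - 3 * xv K (n + 1) 1 ^ 2 * xv K (n + 1) 4
  else
    -(xv K (n + 1) 2) * p K n k + xv K (n + 1) 1 * xv K (n + 1) (k + 1) * xv K (n + 1) (k + 2)
      + xv K (n + 1) 1 *
          ∑ i ∈ Finset.Icc 1 (k - 1), ∑ j ∈ Finset.Icc (k + 1) (2 * k - i + 1),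
            alph k i j • (xv K (n + 1) (i + 1) * xv K (n + 1) (j + 1))
      - xv K (n + 1) 1 ^ 2 * ∑ i ∈ Finset.Icc (k + 1) (2 * k + 1), bet k i • xv K (n + 1) (i + 1)


section CommRing

variable {R : Type*} [CommRing R]

/-- The iterated sum `Σ_t C(e,t) y_{m+t}`, that is `(1 + S)^e y_m` for the shift `S`. -/
def shiftSum (y : ℕ → R) : ℕ → ℕ → R
  | m, 0 => y m
  | m, e + 1 => shiftSum y m e + shiftSum y (m + 1) e

theorem shiftSum_zero (y : ℕ → R) (m : ℕ) : shiftSum y m 0 = y m := rfl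

theorem shiftSum_succ (y : ℕ → R) (m e : ℕ) :
    shiftSum y m (e + 1) = shiftSum y m e + shiftSum y (m + 1) e := rfl

theorem shiftSum_eq_sum (y : ℕ → R) (m e : ℕ) :
    shiftSum y m e = ∑ t ∈ Finset.range (e + 1), (e.choose t : R) * y (m + t) := by
  induction e generalizing m with
  | zero => simp [shiftSum_zero]
  | succ e ih =>
    rw [shiftSum_succ, ih, ih, Finset.sum_range_succ' _ (e + 1)]
    simp only [Nat.choose_succ_succ, Nat.cast_add, add_mul, Finset.sum_add_distrib]
    rw [Finset.sum_range_succ' _ e, Finset.sum_range_succ (fun t => (e.choose (t + 1) : R) * _) e]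
    simp [add_comm, add_left_comm]

theorem map_shiftSum {R' : Type*} [CommRing R'] (f : R →+* R') (y : ℕ → R) (m e : ℕ) :
    f (shiftSum y m e) = shiftSum (fun i => f (y i)) m e := by
  induction e generalizing m with
  | zero => rfl
  | succ e ih => rw [shiftSum_succ, shiftSum_succ, map_add, ih, ih]

theorem ch_natCast (a b : ℕ) : ch a b = a.choose b := by
  unfold ch
  split_ifs with h
  · simp
  · rw [Nat.choose_eq_zero_of_lt (by omega), Nat.cast_zero]

theorem sum_ch_mul (y : ℕ → R) {l u s e : ℕ} (hl : l ≤ s) (hu : s + e ≤ u) :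
    ∑ j ∈ Finset.Icc l u, (ch (e : ℤ) ((j : ℤ) - s) : R) * y j = shiftSum y s e := by
  have hsub : Finset.Ico s (s + e + 1) ⊆ Finset.Icc l u := by
    intro j
    simp only [Finset.mem_Ico, Finset.mem_Icc]
    omega
  rw [← Finset.sum_subset hsub, Finset.sum_Ico_eq_sum_range, shiftSum_eq_sum]
  · rw [show s + e + 1 - s = e + 1 by omega]
    refine Finset.sum_congr rfl fun t _ => ?_
    rw [show ((s + t : ℕ) : ℤ) - s = (t : ℕ) by push_cast; ring, ch_natCast, Int.cast_natCast]
  · intro j _ hj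
    rw [ch, if_neg, Int.cast_zero, zero_mul]
    simp only [Finset.mem_Ico] at hj
    omega

/-- The form `Σ_e (-1)^e y_{k-e} (2 u_e - u_{e-1})` with `u_e = (1 + S)^e y_k`. -/
def quadForm (y : ℕ → R) (k : ℕ) : R :=
  ∑ e ∈ Finset.range (k + 1),
    (-1) ^ e * y (k - e) * (2 * shiftSum y k e - shiftSum y k (e - 1))

/-- The form `Σ_e (-1)^e y_{k-e} ((2e+1) v_e - e v_{e-1})` with `v_e = (1 + S)^e y_{k+1}`. -/
def quadPrimitive (y : ℕ → R) (k : ℕ) : R :=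
  ∑ e ∈ Finset.range (k + 1),
    (-1) ^ e * y (k - e) *
      ((2 * e + 1) * shiftSum y (k + 1) e - e * shiftSum y (k + 1) (e - 1))

theorem map_quadForm {R' : Type*} [CommRing R'] (f : R →+* R') (y : ℕ → R) (k : ℕ) :
    f (quadForm y k) = quadForm (fun i => f (y i)) k := by
  simp [quadForm, map_shiftSum, map_ofNat f 2]

theorem map_quadPrimitive {R' : Type*} [CommRing R'] (f : R →+* R') (y : ℕ → R) (k : ℕ) :
    f (quadPrimitive y k) = quadPrimitive (fun i => f (y i)) k := by
  simp [quadPrimitive, map_shiftSum, map_ofNat f 2]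

/-- Summation by parts for `quadForm`. -/
theorem sum_quadForm_by_parts {a u w : ℕ → R} (hw : ∀ e, w (e + 1) = w e + u e)
    (h0 : a 0 = u 0) (h1 : a 1 = w 0) (m : ℕ) :
    ∑ e ∈ Finset.range (m + 1), (-1) ^ e * (a e + a (e + 1)) * (2 * w (e + 1) - w (e - 1 + 1))
      = ∑ e ∈ Finset.range (m + 1), (-1) ^ e * a e * (2 * u e - u (e - 1))
        + (-1) ^ m * a (m + 1) * (2 * w (m + 1) - w m) := by
  induction m with
  | zero =>
    simp only [zero_add, Finset.sum_range_one, pow_zero, Nat.zero_sub, hw 0, h0, h1]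
    ring
  | succ m ih =>
    rw [Finset.sum_range_succ, ih, Finset.sum_range_succ _ (m + 1)]
    simp only [Nat.add_sub_cancel, hw (m + 1), hw m]
    ring

/-- Summation by parts for `quadPrimitive`. -/
theorem sum_quadPrimitive_by_parts {a u v : ℕ → R} (hu : ∀ e, u (e + 1) = u e + v e) (m : ℕ) :
    ∑ e ∈ Finset.range (m + 1),
        (-1) ^ e * (a e + a (e + 1)) * ((2 * e + 1) * u (e + 1) - e * u (e - 1 + 1))
      = ∑ e ∈ Finset.range (m + 1), (-1) ^ e * a e * ((2 * e + 1) * v e - e * v (e - 1))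
        + ∑ e ∈ Finset.range (m + 1), (-1) ^ e * a e * (2 * u e - u (e - 1))
        + (-1) ^ m * a (m + 1) * ((2 * m + 1) * u (m + 1) - m * u m) := by
  induction m with
  | zero =>
    simp only [zero_add, Finset.sum_range_one, pow_zero, Nat.zero_sub, hu 0, Nat.cast_zero]
    ring
  | succ m ih =>
    rw [Finset.sum_range_succ, ih, Finset.sum_range_succ _ (m + 1),
      Finset.sum_range_succ (fun e => (-1) ^ e * a e * (2 * u e - u (e - 1))) (m + 1)]
    simp only [Nat.add_sub_cancel, hu (m + 1), hu m, Nat.cast_add, Nat.cast_one]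
    ring

/-- `f` acts on `y_0, …, y_N` as the unipotent Jordan block `y_i ↦ y_i + y_{i-1}`. -/
structure IsJordanAction (f : R →+* R) (y : ℕ → R) (N : ℕ) : Prop where
  map_zero : f (y 0) = y 0
  map_succ : ∀ i < N, f (y (i + 1)) = y (i + 1) + y i

namespace IsJordanAction

variable {f : R →+* R} {y : ℕ → R} {N : ℕ}

theorem map_shiftSum_succ (h : IsJordanAction f y N) {m e : ℕ} (hN : m + 1 + e ≤ N) :
    f (shiftSum y (m + 1) e) = shiftSum y m (e + 1) := by
  induction e generalizing m with
  | zero =>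
    simp only [shiftSum_succ, shiftSum_zero]
    rw [h.map_succ m (by omega), add_comm]
  | succ e ih =>
    rw [shiftSum_succ, map_add, ih (by omega), ih (by omega), ← shiftSum_succ]

theorem map_sub (h : IsJordanAction f y N) {k e : ℕ} (hk : k ≤ N) :
    f (if e ≤ k then y (k - e) else 0)
      = (if e ≤ k then y (k - e) else 0) + (if e + 1 ≤ k then y (k - (e + 1)) else 0) := by
  rcases lt_trichotomy e k with he | rfl | he
  · obtain ⟨d, rfl⟩ : ∃ d, k = e + d + 1 := ⟨k - e - 1, by omega⟩
    rw [if_pos (by omega), if_pos (by omega), show e + d + 1 - e = d + 1 by omega,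
      show e + d + 1 - (e + 1) = d by omega, h.map_succ d (by omega)]
  · simp [h.map_zero]
  · rw [if_neg (by omega), if_neg (by omega), _root_.map_zero, add_zero]

theorem sum_congr_ite (k : ℕ) (g : ℕ → R) :
    ∑ e ∈ Finset.range (k + 1), (-1) ^ e * y (k - e) * g e
      = ∑ e ∈ Finset.range (k + 1), (-1) ^ e * (if e ≤ k then y (k - e) else 0) * g e := by
  refine Finset.sum_congr rfl fun e he => ?_
  rw [if_pos (by simpa [Nat.lt_succ_iff] using he)]

theorem map_quadForm (h : IsJordanAction f y N) {k : ℕ} (hk : 1 ≤ k) (hN : 2 * k ≤ N) :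
    f (quadForm y k) = quadForm y k := by
  obtain ⟨l, rfl⟩ : ∃ l, k = l + 1 := ⟨k - 1, by omega⟩
  have key := sum_quadForm_by_parts (a := fun e => if e ≤ l + 1 then y (l + 1 - e) else 0)
    (u := shiftSum y (l + 1)) (w := shiftSum y l) (fun e => shiftSum_succ y l e)
    (by simp [shiftSum_zero]) (by simp [shiftSum_zero]) (l + 1)
  rw [if_neg (by omega), mul_zero, zero_mul, add_zero] at key
  rw [quadForm, sum_congr_ite, map_sum]
  refine Eq.trans ?_ key
  refine Finset.sum_congr rfl fun e he => ?_
  have he' : e < l + 1 + 1 := Finset.mem_range.1 he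
  rw [map_mul, map_mul, h.map_sub (by omega), _root_.map_sub, map_mul,
    h.map_shiftSum_succ (by omega), h.map_shiftSum_succ (by omega)]
  simp [map_ofNat f 2]

theorem map_quadPrimitive (h : IsJordanAction f y N) {k : ℕ} (hN : 2 * k + 1 ≤ N) :
    f (quadPrimitive y k) = quadPrimitive y k + quadForm y k := by
  have key := sum_quadPrimitive_by_parts (a := fun e => if e ≤ k then y (k - e) else 0)
    (u := shiftSum y k) (v := shiftSum y (k + 1)) (fun e => shiftSum_succ y k e) k
  rw [if_neg (by omega), mul_zero, zero_mul, add_zero] at key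
  rw [quadForm, quadPrimitive, sum_congr_ite, sum_congr_ite, map_sum]
  refine Eq.trans ?_ key
  refine Finset.sum_congr rfl fun e he => ?_
  have he' : e < k + 1 := Finset.mem_range.1 he
  rw [map_mul, map_mul, h.map_sub (by omega), _root_.map_sub, map_mul, map_mul,
    h.map_shiftSum_succ (by omega), h.map_shiftSum_succ (by omega)]
  simp [map_ofNat f 2]

theorem map_cubicForm (h : IsJordanAction f y N) {k : ℕ} (hk : 1 ≤ k) (hN : 2 * k + 1 ≤ N) :
    f (-(y 1) * quadForm y k + y 0 * quadPrimitive y k)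
      = -(y 1) * quadForm y k + y 0 * quadPrimitive y k := by
  have h1 := h.map_succ 0 (by omega)
  rw [zero_add] at h1
  rw [map_add, map_mul, map_mul, map_neg, h1, h.map_zero, h.map_quadForm hk (by omega),
    h.map_quadPrimitive hN]
  ring

end IsJordanAction

end CommRing

section Subalgebra

variable {F A : Type*} [Field F] [CommRing A] [Algebra F A] {S : Subalgebra F A} {y : ℕ → A}

theorem shiftSum_mem {m e : ℕ} (h : ∀ i ≤ m + e, y i ∈ S) : shiftSum y m e ∈ S := by
  induction e generalizing m with
  | zero => exact h m le_rfl
  | succ e ih =>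
    exact S.add_mem (ih fun i hi => h i (by omega)) (ih fun i hi => h i (by omega))

theorem mem_of_shiftSum_mem {m e : ℕ} (h : ∀ i < m + e, y i ∈ S) (hs : shiftSum y m e ∈ S) :
    y (m + e) ∈ S := by
  induction e generalizing m with
  | zero => exact hs
  | succ e ih =>
    have hm : shiftSum y (m + 1) e ∈ S := by
      have := S.sub_mem hs (shiftSum_mem (m := m) (e := e) fun i hi => h i (by omega))
      rwa [shiftSum_succ, add_sub_cancel_left] at this
    have := ih (fun i hi => h i (by omega)) hm
    rwa [show m + 1 + e = m + (e + 1) by omega] at this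

theorem neg_one_pow_mem (S : Subalgebra F A) (e : ℕ) : (-1 : A) ^ e ∈ S :=
  S.pow_mem (S.neg_mem S.one_mem) e

theorem mem_of_nat_mul_mul_mem [CharZero F] {c d z : A} (hcd : c * d = 1) (hd : d ∈ S)
    {N : ℕ} (hN : N ≠ 0) (h : (N : A) * (c * z) ∈ S) : z ∈ S := by
  have hN' : (N : F) ≠ 0 := Nat.cast_ne_zero.2 hN
  have := S.smul_mem (S.mul_mem hd h) (N : F)⁻¹
  have e : (N : F)⁻¹ • (d * ((N : A) * (c * z))) = z := by
    rw [show d * ((N : A) * (c * z)) = (N : A) * ((c * d) * z) by ring, hcd, one_mul,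
      ← map_natCast (algebraMap F A), ← Algebra.smul_def, smul_smul, inv_mul_cancel₀ hN', one_smul]
  rwa [e] at this

theorem mem_of_neg_one_pow_mul_mem {e : ℕ} {z : A} (h : (-1) ^ e * z ∈ S) : z ∈ S := by
  have := S.mul_mem (neg_one_pow_mem S e) h
  rwa [← mul_assoc, ← mul_pow, neg_one_mul, neg_neg, one_pow, one_mul] at this

theorem mem_of_quadForm_mem [CharZero F] {d : A} (hd : d ∈ S) (hyd : y 0 * d = 1) {k : ℕ}
    (hk : 1 ≤ k) (h : ∀ i < 2 * k, y i ∈ S) (hq : quadForm y k ∈ S) : y (2 * k) ∈ S := by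
  have hsum : ∀ e < k, shiftSum y k e ∈ S := fun e he => shiftSum_mem fun i hi => h i (by omega)
  rw [quadForm, Finset.sum_range_succ, Nat.sub_self] at hq
  have htop := (add_mem_cancel_left (S.sum_mem fun e he => ?_)).1 hq
  · rw [mul_assoc] at htop
    have h2 := S.add_mem (mem_of_neg_one_pow_mul_mem htop)
      (S.mul_mem (h 0 (by omega)) (hsum (k - 1) (by omega)))
    rw [← mul_add, sub_add_cancel, mul_left_comm] at h2
    rw [two_mul] at h ⊢
    exact mem_of_shiftSum_mem h
      (mem_of_nat_mul_mul_mem (N := 2) hyd hd two_ne_zero (by exact_mod_cast h2))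
  · have he' : e < k := Finset.mem_range.1 he
    refine S.mul_mem (S.mul_mem (neg_one_pow_mem S e) (h _ (by omega)))
      (S.sub_mem (S.mul_mem (S.natCast_mem 2) (hsum e he')) (hsum _ (by omega)))

theorem mem_of_quadPrimitive_mem [CharZero F] {d : A} (hd : d ∈ S) (hyd : y 0 * d = 1) {k : ℕ}
    (h : ∀ i < 2 * k + 1, y i ∈ S) (hq : quadPrimitive y k ∈ S) : y (2 * k + 1) ∈ S := by
  have hsum : ∀ e < k, shiftSum y (k + 1) e ∈ S :=
    fun e he => shiftSum_mem fun i hi => h i (by omega)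
  have hpred : (k : A) * shiftSum y (k + 1) (k - 1) ∈ S := by
    rcases Nat.eq_zero_or_pos k with rfl | hk
    · simp
    · exact S.mul_mem (S.natCast_mem k) (hsum _ (by omega))
  rw [quadPrimitive, Finset.sum_range_succ, Nat.sub_self] at hq
  have htop := (add_mem_cancel_left (S.sum_mem fun e he => ?_)).1 hq
  · rw [mul_assoc] at htop
    have h2 := S.add_mem (mem_of_neg_one_pow_mul_mem htop) (S.mul_mem (h 0 (by omega)) hpred)
    rw [← mul_add, sub_add_cancel, mul_left_comm] at h2
    rw [show 2 * k + 1 = k + 1 + k by omega] at h ⊢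
    exact mem_of_shiftSum_mem h
      (mem_of_nat_mul_mul_mem (N := 2 * k + 1) hyd hd (by omega) (by exact_mod_cast h2))
  · have he' : e < k := Finset.mem_range.1 he
    refine S.mul_mem (S.mul_mem (neg_one_pow_mem S e) (h _ (by omega)))
      (S.sub_mem (S.mul_mem ?_ (hsum e he')) (S.mul_mem (S.natCast_mem e) (hsum _ (by omega))))
    exact_mod_cast S.natCast_mem (2 * e + 1)

/-- A subalgebra containing `y_0^{±1}`, `y_1`, and the quadratic and cubic forms contains
every `y_i`. -/
theorem mem_of_forms_mem [CharZero F] {d : A} (hd : d ∈ S) (hyd : y 0 * d = 1)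
    (h0 : y 0 ∈ S) (h1 : y 1 ∈ S) {N : ℕ}
    (hquad : ∀ k, 1 ≤ k → 2 * k ≤ N → quadForm y k ∈ S)
    (hcubic : ∀ k, 1 ≤ k → 2 * k + 1 ≤ N →
      -(y 1) * quadForm y k + y 0 * quadPrimitive y k ∈ S) :
    ∀ i ≤ N, y i ∈ S := by
  intro i
  induction i using Nat.strong_induction_on with
  | _ i ih =>
    intro hi
    obtain ⟨k, rfl | rfl⟩ := Nat.even_or_odd' i
    · rcases Nat.eq_zero_or_pos k with rfl | hk
      · exact h0
      · exact mem_of_quadForm_mem hd hyd hk (fun i h => ih i h (by omega)) (hquad k hk hi)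
    · rcases Nat.eq_zero_or_pos k with rfl | hk
      · exact h1
      · have hq := (add_mem_cancel_left
          (S.mul_mem (S.neg_mem h1) (hquad k hk (by omega)))).1 (hcubic k hk hi)
        refine mem_of_quadPrimitive_mem hd hyd (fun i h => ih i h (by omega)) ?_
        exact mem_of_nat_mul_mul_mem hyd hd one_ne_zero (by simpa using hq)

/-- If `f` fixes `S` pointwise and translates `x` by a nonzero element of `S`, then the only
`f`-invariants in `S[x]` are the elements of `S`. -/
theorem mem_of_map_eq_self [CharZero F] [IsDomain A] (f : A →ₐ[F] A) (hS : ∀ s ∈ S, f s = s)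
    {x c : A} (hc : c ∈ S) (hc0 : c ≠ 0) (hx : f x = x + c) {a : A}
    (ha : a ∈ Algebra.adjoin S {x}) (hfa : f a = a) : a ∈ S := by
  rw [Algebra.adjoin_singleton_eq_range_aeval] at ha
  obtain ⟨g, hg⟩ := ha
  replace hg : Polynomial.aeval x g = a := hg
  have : CharZero A := charZero_of_injective_algebraMap (algebraMap F A).injective
  have hiter : ∀ m : ℕ, Polynomial.aeval (x + m * c) g = a := by
    intro m
    induction m with
    | zero => simpa using hg
    | succ m ih =>
      have hstep := congrArg f ih
      rw [hfa, Polynomial.aeval_eq_sum_range, map_sum] at hstep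
      rw [← hstep, Polynomial.aeval_eq_sum_range]
      refine Finset.sum_congr rfl fun i _ => ?_
      rw [Subalgebra.smul_def, Subalgebra.smul_def, smul_eq_mul, smul_eq_mul, map_mul,
        hS _ (g.coeff i).2, map_pow, map_add, map_mul, map_natCast, hS c hc, hx]
      push_cast
      ring
  have hconst : g.map (algebraMap S A) = Polynomial.C a := by
    refine Polynomial.eq_of_infinite_eval_eq _ _ (Set.Infinite.mono ?_
      (Set.infinite_range_of_injective (f := fun m : ℕ => x + m * c) fun m m' hm => ?_))
    · rintro _ ⟨m, rfl⟩
      simpa [Polynomial.eval_map_algebraMap] using hiter m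
    · simpa [hc0] using hm
  have hcoeff := congrArg (fun r => Polynomial.coeff r 0) hconst
  simp only [Polynomial.coeff_map, Polynomial.coeff_C_zero] at hcoeff
  rw [← hcoeff]
  exact (g.coeff 0).2

end Subalgebra

/-- A subalgebra of a localization of a polynomial ring at one element is everything as soon as it
contains the variables and the inverse of that element. -/
theorem mem_of_X_mem_of_invSelf_mem {F : Type*} [Field F] {σ : Type*} {x : MvPolynomial σ F}
    {S : Subalgebra F (Localization.Away x)}
    (hX : ∀ i, algebraMap (MvPolynomial σ F) (Localization.Away x) (MvPolynomial.X i) ∈ S)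
    (hinv : IsLocalization.Away.invSelf x ∈ S) (a : Localization.Away x) : a ∈ S := by
  have hg : ∀ r, algebraMap (MvPolynomial σ F) (Localization.Away x) r ∈ S := by
    intro r
    induction r using MvPolynomial.induction_on with
    | C c =>
      rw [← MvPolynomial.algebraMap_eq, ← IsScalarTower.algebraMap_apply]
      exact S.algebraMap_mem c
    | add r s hr hs => rw [map_add]; exact S.add_mem hr hs
    | mul_X r i hr => rw [map_mul]; exact S.mul_mem hr (hX i)
  obtain ⟨m, r, hr⟩ := IsLocalization.Away.surj x a
  have ha : a = algebraMap _ _ r * IsLocalization.Away.invSelf x ^ m := by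
    rw [← hr, mul_assoc, ← mul_pow, IsLocalization.Away.mul_invSelf, one_pow, mul_one]
  rw [ha]
  exact S.mul_mem (hg r) (S.pow_mem hinv m)

theorem sum_Icc_one_eq_sum_range {M : Type*} [AddCommMonoid M] (l : ℕ) (g : ℕ → M) :
    ∑ i ∈ Finset.Icc 1 l, g i = ∑ e ∈ Finset.range l, g (l - e) := by
  refine Finset.sum_nbij' (fun i => l - i) (fun e => l - e) ?_ ?_ ?_ ?_ ?_ <;>
    intro i hi <;> simp only [Finset.mem_Icc, Finset.mem_range] at hi ⊢ <;> try omega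
  rw [show l - (l - i) = i by omega]

section Coefficients

variable {R : Type*} [CommRing R]

theorem sum_lam (y : ℕ → R) (k e : ℕ) (he : e < k) :
    ∑ j ∈ Finset.Icc k (2 * k - (k - (e + 1))), (lam k (k - (e + 1)) j : R) * y j
      = (-1) ^ (e + 1) * (2 * shiftSum y k (e + 1) - shiftSum y k e) := by
  have h1 := sum_ch_mul y (l := k) (u := 2 * k - (k - (e + 1))) (s := k) (e := e + 1)
    le_rfl (by omega)
  have h2 := sum_ch_mul y (l := k) (u := 2 * k - (k - (e + 1))) (s := k + 1) (e := e)
    (by omega) (by omega)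
  have h3 : (2 * shiftSum y k (e + 1) - shiftSum y k e)
      = shiftSum y k (e + 1) + shiftSum y (k + 1) e := by
    rw [shiftSum_succ]; ring
  rw [h3, ← h1, ← h2, ← Finset.sum_add_distrib, Finset.mul_sum]
  refine Finset.sum_congr rfl fun j _ => ?_
  rw [lam, show k - (k - (e + 1)) = e + 1 by omega,
    show (k : ℤ) - ((k - (e + 1) : ℕ) : ℤ) = (e + 1 : ℕ) by omega,
    show ((e + 1 : ℕ) : ℤ) - 1 = e by omega,
    show (j : ℤ) - k - 1 = j - (k + 1 : ℕ) by omega]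
  push_cast
  ring

theorem sum_mu (y : ℕ → R) (l : ℕ) :
    ∑ j ∈ Finset.Icc (l + 1) (2 * (l + 1)), (mu (l + 1) j : R) * y j
      = (-1) ^ l * (2 * shiftSum y (l + 1) (l + 1) - shiftSum y (l + 1) l) := by
  have h := sum_lam y (l + 1) l (by omega)
  rw [Nat.sub_self, Nat.sub_zero, pow_succ, mul_neg_one, neg_mul, ← neg_eq_iff_eq_neg] at h
  rw [← h, ← Finset.sum_neg_distrib]
  refine Finset.sum_congr rfl fun j _ => ?_
  simp only [mu, lam, Nat.add_sub_cancel, Nat.sub_zero, Nat.cast_zero, sub_zero]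
  push_cast
  ring

/-- The combination of shifted sums produced by the coefficients `α^k_{k-e-1, ·}`. -/
theorem sum_alph (y : ℕ → R) {k e l u s : ℕ} (he : e < k) (hl : l ≤ s) (hu : s + e + 1 ≤ u)
    (j' : ℕ → ℕ) (hj : ∀ j ∈ Finset.Icc l u, (j' j : ℤ) - k - 1 = j - s) :
    ∑ j ∈ Finset.Icc l u, (alph k (k - (e + 1)) (j' j) : R) * y j
      = (-1) ^ (e + 1) * ((2 * (e + 1) + 1) * shiftSum y s (e + 1) - (e + 1) * shiftSum y s e) := by
  have h1 := sum_ch_mul y (l := l) (u := u) (s := s) (e := e) hl (by omega)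
  have h2 := sum_ch_mul y (l := l) (u := u) (s := s + 1) (e := e) (by omega) (by omega)
  have h3 := sum_ch_mul y (l := l) (u := u) (s := s) (e := e + 1) hl (by omega)
  have h4 : ((2 * (e + 1) + 1) * shiftSum y s (e + 1) - (e + 1) * shiftSum y s e)
      = 2 * shiftSum y s e + 3 * shiftSum y (s + 1) e
        + e * (shiftSum y s (e + 1) + shiftSum y (s + 1) e) := by
    rw [shiftSum_succ]; ring
  rw [h4, ← h1, ← h2, ← h3]
  simp only [← Finset.sum_add_distrib, Finset.mul_sum]
  refine Finset.sum_congr rfl fun j hj' => ?_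
  rw [alph, hj j hj', show k - (k - (e + 1)) = e + 1 by omega,
    show (k : ℤ) - ((k - (e + 1) : ℕ) : ℤ) = (e + 1 : ℕ) by omega,
    show ((e + 1 : ℕ) : ℤ) - 1 = e by omega,
    show (j' j : ℤ) - k - 2 = j - (s + 1 : ℕ) by have := hj j hj'; omega]
  push_cast
  ring

theorem sum_bet (y : ℕ → R) (l : ℕ) :
    ∑ j ∈ Finset.Icc (l + 2 + 1) (2 * (l + 2) + 1), (bet (l + 2) j : R) * y j
      = (-1) ^ (l + 1) * ((2 * (l + 2) + 1) * shiftSum y (l + 2 + 1) (l + 2)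
        - (l + 2) * shiftSum y (l + 2 + 1) (l + 1)) := by
  have h1 := sum_alph y (k := l + 2) (e := l) (l := l + 2 + 1) (u := 2 * (l + 2) + 1)
    (s := l + 2 + 2) (by omega) (by omega) (by omega) (fun j => j - 1)
    (fun j hj => by have := (Finset.mem_Icc.1 hj).1; omega)
  have h2 := sum_alph y (k := l + 2) (e := l) (l := l + 2 + 1) (u := 2 * (l + 2) + 1)
    (s := l + 2 + 1) (by omega) (by omega) (by omega) (fun j => j)
    (fun j hj => by omega)
  have h3 : ∑ j ∈ Finset.Icc (l + 2 + 1) (2 * (l + 2) + 1), (mu (l + 2) (j - 1) : R) * y j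
      = (-1) ^ (l + 1) * (2 * shiftSum y (l + 2 + 1) (l + 2) - shiftSum y (l + 2 + 1) (l + 1)) := by
    have hmap : ∀ m e, shiftSum (fun i => y (i + 1)) m e = shiftSum y (m + 1) e := by
      intro m e
      induction e generalizing m with
      | zero => rfl
      | succ e ih => rw [shiftSum_succ, shiftSum_succ, ih, ih]
    rw [← hmap, ← hmap, ← sum_mu (fun i => y (i + 1)) (l + 1)]
    refine Finset.sum_nbij' (fun j => j - 1) (fun j => j + 1) ?_ ?_ ?_ ?_ ?_ <;>
      intro j hj <;> simp only [Finset.mem_Icc] at hj ⊢ <;> try omega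
    rw [show j - 1 + 1 = j by omega]
  rw [show l + 2 - (l + 1) = 1 by omega] at h1 h2
  simp only [bet, Int.cast_add, add_mul, Finset.sum_add_distrib]
  rw [h1, h2, h3, shiftSum_succ y (l + 2 + 1) (l + 1), shiftSum_succ y (l + 2 + 1) l,
    shiftSum_succ y (l + 2 + 1 + 1) l]
  ring

end Coefficients

theorem p_eq_quadForm {L : Type*} [Field L] {n k : ℕ} (hk : 1 ≤ k) :
    p L n k = quadForm (fun i => xv L (n + 1) (i + 1)) k := by
  obtain ⟨l, rfl⟩ : ∃ l, k = l + 1 := ⟨k - 1, by omega⟩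
  set y := fun i => xv L (n + 1) (i + 1) with hy
  have hmu := sum_mu y l
  have hlam : ∀ e ∈ Finset.range l,
      ∑ j ∈ Finset.Icc (l + 1) (2 * (l + 1) - (l - e)), lam (l + 1) (l - e) j • (y (l - e) * y j)
      = (-1) ^ (e + 1) * y (l + 1 - (e + 1))
        * (2 * shiftSum y (l + 1) (e + 1) - shiftSum y (l + 1) (e + 1 - 1)) := by
    intro e he
    have := sum_lam y (l + 1) e (by have := Finset.mem_range.1 he; omega)
    rw [Nat.add_sub_add_right] at this ⊢
    rw [mul_right_comm, Nat.add_sub_cancel, ← this, Finset.sum_mul]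
    refine Finset.sum_congr rfl fun j _ => ?_
    rw [zsmul_eq_mul]
    ring
  rw [quadForm, Finset.sum_range_succ, Finset.sum_range_succ', ← Finset.sum_congr rfl hlam,
    ← sum_Icc_one_eq_sum_range l fun i =>
      ∑ j ∈ Finset.Icc (l + 1) (2 * (l + 1) - i), lam (l + 1) i j • (y i * y j)]
  simp only [p, zsmul_eq_mul, Nat.add_sub_cancel, Nat.sub_self, Nat.zero_sub, Nat.sub_zero,
    shiftSum_zero]
  simp only [hy] at hmu ⊢
  rw [hmu]
  ring

theorem q_one_eq {L : Type*} [Field L] {n : ℕ} :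
    q L n 1 = xv L (n + 1) 1 ^ 3 - xv L (n + 1) 1 * quadForm (fun i => xv L (n + 1) (i + 1)) 1
      + (-(xv L (n + 1) 2) * quadForm (fun i => xv L (n + 1) (i + 1)) 1
        + xv L (n + 1) 1 * quadPrimitive (fun i => xv L (n + 1) (i + 1)) 1) := by
  simp only [q, quadForm, quadPrimitive, Finset.sum_range_succ, Finset.sum_range_zero,
    shiftSum_succ, shiftSum_zero, if_true, Nat.sub_self, Nat.sub_zero, Nat.zero_sub]
  norm_num
  ring

theorem q_eq {L : Type*} [Field L] {n k : ℕ} (hk : 2 ≤ k) :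
    q L n k = -(xv L (n + 1) 2) * quadForm (fun i => xv L (n + 1) (i + 1)) k
      + xv L (n + 1) 1 * quadPrimitive (fun i => xv L (n + 1) (i + 1)) k := by
  obtain ⟨l, rfl⟩ : ∃ l, k = l + 2 := ⟨k - 2, by omega⟩
  set y := fun i => xv L (n + 1) (i + 1) with hy
  have hbet := sum_bet y l
  have halph : ∀ e ∈ Finset.range (l + 1),
      ∑ j ∈ Finset.Icc (l + 2 + 1) (2 * (l + 2) - (l + 1 - e) + 1),
        alph (l + 2) (l + 1 - e) j • (y (l + 1 - e) * y j)
      = (-1) ^ (e + 1) * y (l + 2 - (e + 1))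
        * ((2 * ((e + 1 : ℕ) : MvPolynomial (Fin (n + 1)) L) + 1) * shiftSum y (l + 2 + 1) (e + 1)
          - ((e + 1 : ℕ) : MvPolynomial (Fin (n + 1)) L)
            * shiftSum y (l + 2 + 1) (e + 1 - 1)) := by
    intro e he
    have he' := Finset.mem_range.1 he
    have := sum_alph y (k := l + 2) (e := e) (l := l + 2 + 1)
      (u := 2 * (l + 2) - (l + 1 - e) + 1) (s := l + 2 + 1) (by omega) le_rfl (by omega)
      (fun j => j) (fun j hj => by omega)
    rw [show l + 2 - (e + 1) = l + 1 - e by omega] at this ⊢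
    rw [Nat.add_sub_cancel]
    push_cast
    rw [mul_right_comm, ← this, Finset.sum_mul]
    refine Finset.sum_congr rfl fun j _ => ?_
    rw [zsmul_eq_mul]
    ring
  rw [quadPrimitive, Finset.sum_range_succ, Finset.sum_range_succ', ← Finset.sum_congr rfl halph,
    ← sum_Icc_one_eq_sum_range (l + 1) fun i =>
      ∑ j ∈ Finset.Icc (l + 2 + 1) (2 * (l + 2) - i + 1), alph (l + 2) i j • (y i * y j)]
  rw [q, if_neg (by omega), p_eq_quadForm (by omega), ← hy]
  simp only [zsmul_eq_mul, show l + 2 - 1 = l + 1 by omega, Nat.sub_self, Nat.sub_zero,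
    shiftSum_zero, Nat.cast_zero]
  simp only [hy] at hbet ⊢
  rw [hbet]
  push_cast
  ring

/-- The invariants of the extension of `τ` to the localization `P_{n+1, x_1}` form the
`K`-algebra generated by `x_1, x_1^{−1}, p_1, …, p_m, q_1, …, q_μ`. -/
theorem localized_fixed_algebra {K : Type*} [Field K] [CharZero K] {n : ℕ} (hn : 2 ≤ n)
    (τ : MvPolynomial (Fin (n + 1)) K ≃ₐ[K] MvPolynomial (Fin (n + 1)) K)
    (hτ1 : τ (xv K (n + 1) 1) = xv K (n + 1) 1)
    (hτ : ∀ k, 2 ≤ k → k ≤ n + 1 → τ (xv K (n + 1) k) = xv K (n + 1) k + xv K (n + 1) (k - 1))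
    (τ' : Localization.Away (xv K (n + 1) 1) ≃ₐ[K] Localization.Away (xv K (n + 1) 1))
    (hτ' : ∀ pp : MvPolynomial (Fin (n + 1)) K,
      τ' (algebraMap (MvPolynomial (Fin (n + 1)) K) (Localization.Away (xv K (n + 1) 1)) pp)
        = algebraMap (MvPolynomial (Fin (n + 1)) K) (Localization.Away (xv K (n + 1) 1)) (τ pp)) :
    {a : Localization.Away (xv K (n + 1) 1) | τ' a = a}
      = ↑(Algebra.adjoin K
          (insert
            (algebraMap (MvPolynomial (Fin (n + 1)) K) (Localization.Away (xv K (n + 1) 1))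
              (xv K (n + 1) 1))
            (insert (IsLocalization.Away.invSelf (S := Localization.Away (xv K (n + 1) 1))
                (xv K (n + 1) 1))
              ((Set.range fun a : Fin (n / 2) =>
                  algebraMap (MvPolynomial (Fin (n + 1)) K) (Localization.Away (xv K (n + 1) 1))
                    (p K n ((a : ℕ) + 1)))
                ∪ (Set.range fun b : Fin ((n - 1) / 2) =>
                    algebraMap (MvPolynomial (Fin (n + 1)) K)
                      (Localization.Away (xv K (n + 1) 1)) (q K n ((b : ℕ) + 1))))))) := by
  set A := Localization.Away (xv K (n + 1) 1)
  set g := algebraMap (MvPolynomial (Fin (n + 1)) K) A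
  set d : A := IsLocalization.Away.invSelf (xv K (n + 1) 1)
  set G : Set A := insert _ (insert d _)
  set y : ℕ → A := fun i => g (xv K (n + 1) (i + 1))
  have hx1 : xv K (n + 1) 1 ≠ 0 := by
    simp [xv, MvPolynomial.X_ne_zero]
  have : IsDomain A := IsLocalization.Away.isDomain A hx1
  have hyd : y 0 * d = 1 := IsLocalization.Away.mul_invSelf (S := A) (xv K (n + 1) 1)
  have hy0 : y 0 ≠ 0 := left_ne_zero_of_mul_eq_one hyd
  have hJ : IsJordanAction (τ' : A →+* A) y n := by
    refine ⟨?_, fun i hi => ?_⟩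
    · change τ' (g _) = g _
      rw [hτ', hτ1]
    · change τ' (g _) = g _ + g _
      rw [hτ', hτ (i + 1 + 1) (by omega) (by omega), map_add]
      rfl
  have hfy0 : τ' (y 0) = y 0 := hJ.map_zero
  have hfy1 : τ' (y 1) = y 1 + y 0 := hJ.map_succ 0 (by omega)
  have hp : ∀ {k}, 1 ≤ k → g (p K n k) = quadForm y k := fun hk => by
    rw [p_eq_quadForm hk, map_quadForm]
  have hq : ∀ {k}, 1 ≤ k → g (q K n k) = (if k = 1 then y 0 ^ 3 - y 0 * quadForm y 1 else 0)
      + (-(y 1) * quadForm y k + y 0 * quadPrimitive y k) := fun {k} hk => by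
    rcases hk.eq_or_lt' with rfl | hk
    · simp [q_one_eq, map_quadForm, map_quadPrimitive, y, -neg_mul]
    · simp [q_eq hk, map_quadForm, map_quadPrimitive, y, hk.ne', -neg_mul]
  have hGp : ∀ {k}, 1 ≤ k → 2 * k ≤ n → quadForm y k ∈ Algebra.adjoin K G := fun {k} hk hkn => by
    refine Algebra.subset_adjoin (Or.inr (Or.inr (Or.inl ⟨⟨k - 1, by omega⟩, ?_⟩)))
    simp only [Nat.sub_add_cancel hk]
    exact hp hk
  have hG0 : y 0 ∈ Algebra.adjoin K G := Algebra.subset_adjoin (Or.inl rfl)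
  have hGd : d ∈ Algebra.adjoin K G := Algebra.subset_adjoin (Or.inr (Or.inl rfl))
  have hGc : ∀ {k}, 1 ≤ k → 2 * k + 1 ≤ n →
      -(y 1) * quadForm y k + y 0 * quadPrimitive y k ∈ Algebra.adjoin K G :=
    fun {k} hk hkn => by
      have hmem : g (q K n k) ∈ Algebra.adjoin K G := by
        refine Algebra.subset_adjoin (Or.inr (Or.inr (Or.inr ⟨⟨k - 1, by omega⟩, ?_⟩)))
        simp only [Nat.sub_add_cancel hk]
      rw [hq hk] at hmem
      refine (add_mem_cancel_left ?_).1 hmem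
      split_ifs
      · exact sub_mem (pow_mem hG0 3) (mul_mem hG0 (hGp le_rfl hn))
      · exact zero_mem _
  have hfix : ∀ s ∈ Algebra.adjoin K G, τ' s = s := by
    refine Algebra.adjoin_le (S := AlgHom.equalizer (τ' : A →ₐ[K] A) (AlgHom.id K A)) ?_
    rintro _ (rfl | rfl | ⟨a, rfl⟩ | ⟨b, rfl⟩)
    · exact hfy0
    · change τ' d = d
      refine mul_left_cancel₀ hy0 ?_
      rw [hyd, ← map_one τ', ← hyd, map_mul, hfy0]
    · have := a.2
      change τ' (g (p K n (a + 1))) = g (p K n (a + 1))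
      rw [hp (by omega)]
      exact hJ.map_quadForm (by omega) (by omega)
    · have := b.2
      change τ' (g (q K n (b + 1))) = g (q K n (b + 1))
      rw [hq (by omega), map_add]
      refine congrArg₂ _ ?_ (hJ.map_cubicForm (by omega) (by omega))
      split_ifs
      · have hquad : τ' (quadForm y 1) = quadForm y 1 := hJ.map_quadForm le_rfl hn
        rw [map_sub, map_pow, map_mul, hfy0, hquad]
      · exact map_zero τ'
  refine Set.Subset.antisymm (fun a ha => ?_) hfix
  refine mem_of_map_eq_self (τ' : A →ₐ[K] A) hfix hG0 hy0 hfy1 ?_ ha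
  let T : Subalgebra K A := (Algebra.adjoin (Algebra.adjoin K G) {y 1}).restrictScalars K
  have hT : ∀ s ∈ Algebra.adjoin K G, s ∈ T := fun s hs =>
    (Algebra.adjoin (Algebra.adjoin K G) {y 1}).algebraMap_mem ⟨s, hs⟩
  have hT1 : y 1 ∈ T := by
    change y 1 ∈ Algebra.adjoin (Algebra.adjoin K G) {y 1}
    exact Algebra.self_mem_adjoin_singleton _ (y 1)
  have hyT : ∀ i ≤ n, y i ∈ T :=
    mem_of_forms_mem (hT d hGd) hyd (hT _ hG0) hT1 (fun k hk hkn => hT _ (hGp hk hkn))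
      fun k hk hkn => hT _ (hGc hk hkn)
  refine mem_of_X_mem_of_invSelf_mem (S := T) (fun i => ?_) (hT d hGd) a
  have hX : MvPolynomial.X i = xv K (n + 1) (i + 1) := by simp [xv, i.is_le]
  rw [hX]
  exact hyT i (by omega)
end
end
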